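/- In the localization A_x of A_N = k⟨x,y⟩/(yx - xy - x^N) at the powers of x, the center of A_x equals k, for all N ≥ 1. -/

import Mathlib

noncomputable section

/-- The relation `yx = xy + x^N` on the free algebra on two generators. -/
inductive AnRel (k : Type*) [Field k] (N : ℕ) :
    FreeAlgebra k (Fin 2) → FreeAlgebra k (Fin 2) → Prop
  | comm : AnRel k N (FreeAlgebra.ι k 1 * FreeAlgebra.ι k 0)
      (FreeAlgebra.ι k 0 * FreeAlgebra.ι k 1 + FreeAlgebra.ι k 0 ^ N)

/-- The algebra `A_N = k⟨x,y⟩/(yx - xy - x^N)`. -/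
abbrev AN (k : Type*) [Field k] (N : ℕ) := RingQuot (AnRel k N)

/-- The generator `x` of `A_N`. -/
def Ax (k : Type*) [Field k] (N : ℕ) : AN k N :=
  RingQuot.mkAlgHom k (AnRel k N) (FreeAlgebra.ι k 0)

/-- The generator `y` of `A_N`. -/
def Ay (k : Type*) [Field k] (N : ℕ) : AN k N :=
  RingQuot.mkAlgHom k (AnRel k N) (FreeAlgebra.ι k 1)

open Polynomial in
lemma ANaux_yx (k : Type*) [Field k] (N : ℕ) :
    Ay k N * Ax k N = Ax k N * Ay k N + Ax k N ^ N := by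
  have := RingQuot.mkAlgHom_rel k (AnRel.comm (k := k) (N := N))
  simpa [Ax, Ay] using this

open Polynomial in
lemma ANaux_yp (k : Type*) [Field k] (N : ℕ) (hN : 1 ≤ N) (p : k[X]) :
    Ay k N * aeval (Ax k N) p =
      aeval (Ax k N) p * Ay k N + aeval (Ax k N) (X ^ N * derivative p) := by
  induction p using Polynomial.induction_on' with
  | add p q hp hq =>
    simp only [map_add, mul_add, add_mul, hp, hq]; abel
  | monomial n c =>
    rw [← C_mul_X_pow_eq_monomial]
    have key : ∀ n : ℕ, Ay k N * Ax k N ^ n =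
        Ax k N ^ n * Ay k N + aeval (Ax k N) (X ^ N * derivative (X ^ n : k[X])) := by
      intro n
      induction n with
      | zero => simp
      | succ n ih =>
        rw [pow_succ, ← mul_assoc, ih, add_mul, mul_assoc, ANaux_yx, mul_add, ← mul_assoc,
          ← pow_succ, add_assoc, pow_succ X n, derivative_mul]
        congr 1
        simp only [derivative_X, mul_one, mul_add, map_add, map_mul, map_pow, aeval_X]
        rw [← pow_add, ← pow_add, add_comm N n, mul_assoc, add_comm]
    have h2 : derivative (C c * X ^ n : k[X]) = C c * derivative (X ^ n) := by
      rw [derivative_C_mul]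
    rw [h2, mul_left_comm, map_mul, map_mul, aeval_C, map_pow, aeval_X,
      ← Algebra.smul_def,
      ← Algebra.smul_def, mul_smul_comm, key, smul_add, smul_mul_assoc]


open Polynomial in
/-- The operator of left multiplication by `y` on normal forms. -/
def ANaux_Y (k : Type*) [Field k] (N : ℕ) : Module.End k k[X][X] :=
  Polynomial.lsum (R := k) fun n =>
    (monomial (n + 1) : k[X] →ₗ[k[X]] k[X][X]).restrictScalars k +
    ((monomial n : k[X] →ₗ[k[X]] k[X][X]).restrictScalars k) ∘ₗ
      (LinearMap.mulLeft k (X ^ N : k[X]) ∘ₗ (derivative : k[X] →ₗ[k] k[X]))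

open Polynomial in
lemma ANaux_Y_monomial (k : Type*) [Field k] (N n : ℕ) (p : k[X]) :
    ANaux_Y k N (monomial n p) = monomial (n + 1) p + monomial n (X ^ N * derivative p) := by
  simp [ANaux_Y, Polynomial.lsum_apply, sum_monomial_index]

open Polynomial in
lemma ANaux_Y_coeff (k : Type*) [Field k] (N n : ℕ) (P : k[X][X]) :
    (ANaux_Y k N P).coeff (n + 1) = P.coeff n + X ^ N * derivative (P.coeff (n + 1)) := by
  induction P using Polynomial.induction_on' with
  | add p q hp hq => simp only [map_add, coeff_add, hp, hq, mul_add]; abel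
  | monomial m p =>
    rw [ANaux_Y_monomial]
    simp only [coeff_add, coeff_monomial, add_left_inj]
    split_ifs <;> simp

open Polynomial in
lemma ANaux_Y_X (k : Type*) [Field k] (N : ℕ) (P : k[X][X]) :
    ANaux_Y k N (C X * P) = C X * ANaux_Y k N P + C (X ^ N) * P := by
  induction P using Polynomial.induction_on' with
  | add p q hp hq => simp only [map_add, hp, hq, mul_add]; abel
  | monomial m p =>
    rw [C_mul_monomial, ANaux_Y_monomial, ANaux_Y_monomial, mul_add, C_mul_monomial,
      C_mul_monomial, C_mul_monomial, add_assoc, ← map_add]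
    congr 2
    rw [derivative_mul, derivative_X]; ring

open Polynomial in
def ANaux_rho (k : Type*) [Field k] (N : ℕ) : AN k N →ₐ[k] Module.End k k[X][X] :=
  RingQuot.liftAlgHom k ⟨FreeAlgebra.lift k
    (fun i : Fin 2 => if i = 0 then LinearMap.mulLeft k (C X : k[X][X]) else ANaux_Y k N), by
    rintro _ _ ⟨⟩
    ext1 P
    simp [ANaux_Y_X, LinearMap.pow_mulLeft]⟩

open Polynomial in
lemma ANaux_rho_x (k : Type*) [Field k] (N : ℕ) :
    ANaux_rho k N (Ax k N) = LinearMap.mulLeft k (C X : k[X][X]) := by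
  simp [ANaux_rho, Ax]

open Polynomial in
lemma ANaux_rho_y (k : Type*) [Field k] (N : ℕ) :
    ANaux_rho k N (Ay k N) = ANaux_Y k N := by
  simp [ANaux_rho, Ay]

open Polynomial in
lemma ANaux_rho_p (k : Type*) [Field k] (N : ℕ) (p : k[X]) (P : k[X][X]) :
    ANaux_rho k N (aeval (Ax k N) p) P = C p * P := by
  induction p using Polynomial.induction_on generalizing P with
  | C a => simp [Algebra.smul_def]
  | add p q hp hq => simp [hp, hq, add_mul]
  | monomial n a h =>
    rw [pow_succ, ← mul_assoc, map_mul, map_mul, Module.End.mul_apply, aeval_X, ANaux_rho_x,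
      LinearMap.mulLeft_apply, h, ← mul_assoc, ← C_mul]

open Polynomial in
/-- The map from normal forms to the algebra. -/
def ANaux_g (k : Type*) [Field k] (N : ℕ) (P : k[X][X]) : AN k N :=
  eval₂ (aeval (Ax k N) : k[X] →ₐ[k] AN k N).toRingHom (Ay k N) P

open Polynomial in
lemma ANaux_g_add (k : Type*) [Field k] (N : ℕ) (P Q : k[X][X]) :
    ANaux_g k N (P + Q) = ANaux_g k N P + ANaux_g k N Q := eval₂_add _ _

open Polynomial in
lemma ANaux_g_monomial (k : Type*) [Field k] (N n : ℕ) (p : k[X]) :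
    ANaux_g k N (monomial n p) = aeval (Ax k N) p * Ay k N ^ n := by
  simp [ANaux_g]

open Polynomial in
lemma ANaux_g_C (k : Type*) [Field k] (N : ℕ) (p : k[X]) :
    ANaux_g k N (C p) = aeval (Ax k N) p := by
  simp [ANaux_g]

open Polynomial in
lemma ANaux_g_Cmul (k : Type*) [Field k] (N : ℕ) (p : k[X]) (P : k[X][X]) :
    ANaux_g k N (C p * P) = aeval (Ax k N) p * ANaux_g k N P := by
  induction P using Polynomial.induction_on' with
  | add P Q hp hq => rw [mul_add, ANaux_g_add, hp, hq, ANaux_g_add, mul_add]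
  | monomial m q =>
    rw [C_mul_monomial, ANaux_g_monomial, ANaux_g_monomial, map_mul, mul_assoc]

open Polynomial in
lemma ANaux_g_Y (k : Type*) [Field k] (N : ℕ) (hN : 1 ≤ N) (P : k[X][X]) :
    ANaux_g k N (ANaux_Y k N P) = Ay k N * ANaux_g k N P := by
  induction P using Polynomial.induction_on' with
  | add P Q hp hq => rw [map_add, ANaux_g_add, hp, hq, ANaux_g_add, mul_add]
  | monomial m q =>
    rw [ANaux_Y_monomial, ANaux_g_add, ANaux_g_monomial, ANaux_g_monomial, ANaux_g_monomial,
      ← mul_assoc, ANaux_yp k N hN, add_mul, pow_succ', mul_assoc]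

open Polynomial in
lemma ANaux_g_rho (k : Type*) [Field k] (N : ℕ) (hN : 1 ≤ N) (a : AN k N) (P : k[X][X]) :
    ANaux_g k N (ANaux_rho k N a P) = a * ANaux_g k N P := by
  obtain ⟨w, rfl⟩ := RingQuot.mkAlgHom_surjective k (AnRel k N) a
  induction w using FreeAlgebra.induction generalizing P with
  | grade0 r =>
    have h := ANaux_rho_p k N (C r) P
    rw [aeval_C] at h
    rw [AlgHom.commutes, h, ANaux_g_Cmul, aeval_C]
  | grade1 i =>
    fin_cases i
    · have h := ANaux_rho_x k N
      have h2 := ANaux_g_Cmul k N X P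
      rw [aeval_X] at h2
      simp only [Ax] at h h2
      simp only [Fin.zero_eta, h, LinearMap.mulLeft_apply, h2]
    · have h := ANaux_rho_y k N
      have h2 := ANaux_g_Y k N hN P
      simp only [Ay] at h h2
      simp only [Fin.mk_one, h, h2]
  | mul a b ha hb => rw [map_mul, map_mul, Module.End.mul_apply, ha, hb, mul_assoc]
  | add a b ha hb => rw [map_add, map_add, LinearMap.add_apply, ANaux_g_add, ha, hb, add_mul]

open Polynomial in
lemma ANaux_g_phi (k : Type*) [Field k] (N : ℕ) (hN : 1 ≤ N) (a : AN k N) :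
    ANaux_g k N (ANaux_rho k N a 1) = a := by
  rw [ANaux_g_rho k N hN, ← C_1, ANaux_g_C, map_one, mul_one]

open Polynomial in
lemma ANaux_phi_ypow (k : Type*) [Field k] (N n : ℕ) :
    ANaux_rho k N (Ay k N ^ n) 1 = monomial n 1 := by
  induction n with
  | zero => simp
  | succ n ih =>
    rw [pow_succ', map_mul, Module.End.mul_apply, ih, ANaux_rho_y, ANaux_Y_monomial]
    simp

open Polynomial in
lemma ANaux_comm (k : Type*) [Field k] (N n : ℕ) :
    (∀ i, n ≤ i →
      (ANaux_rho k N (Ay k N ^ n * Ax k N - Ax k N * Ay k N ^ n) 1).coeff i = 0) ∧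
    (ANaux_rho k N (Ay k N ^ (n + 1) * Ax k N - Ax k N * Ay k N ^ (n + 1)) 1).coeff n
      = ((n + 1 : ℕ) : k[X]) * X ^ N := by
  have step : ∀ n, ANaux_rho k N (Ay k N ^ (n + 1) * Ax k N - Ax k N * Ay k N ^ (n + 1)) 1 =
      ANaux_Y k N (ANaux_rho k N (Ay k N ^ n * Ax k N - Ax k N * Ay k N ^ n) 1) +
      monomial n (X ^ N) := by
    intro n
    have h1 : Ay k N ^ (n + 1) * Ax k N - Ax k N * Ay k N ^ (n + 1) =
      Ay k N * (Ay k N ^ n * Ax k N - Ax k N * Ay k N ^ n) +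
        aeval (Ax k N) (X ^ N : k[X]) * Ay k N ^ n := by
      rw [pow_succ', mul_sub, ← mul_assoc, ← mul_assoc, ← mul_assoc, ANaux_yx, map_pow, aeval_X,
        add_mul]
      abel
    rw [h1, map_add, LinearMap.add_apply, map_mul, Module.End.mul_apply, ANaux_rho_y, map_mul,
      Module.End.mul_apply, ANaux_phi_ypow, ANaux_rho_p, C_mul_monomial, mul_one]
  have hdeg : ∀ n i, n ≤ i →
      (ANaux_rho k N (Ay k N ^ n * Ax k N - Ax k N * Ay k N ^ n) 1).coeff i = 0 := by
    intro n
    induction n with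
    | zero => simp
    | succ n ih =>
      intro i hi
      obtain ⟨i, rfl⟩ : ∃ j, i = j + 1 := ⟨i - 1, by omega⟩
      rw [step, coeff_add, ANaux_Y_coeff, ih i (by omega), ih (i + 1) (by omega),
        coeff_monomial, if_neg (by omega)]
      simp
  refine ⟨hdeg n, ?_⟩
  induction n with
  | zero => rw [step]; simp; rw [← C_pow, coeff_C_zero]
  | succ n ih =>
    rw [step, coeff_add, ANaux_Y_coeff, ih, hdeg (n + 1) (n + 1) le_rfl, coeff_monomial, if_pos rfl]
    push_cast
    simp
    ring

open Polynomial in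
lemma ANaux_centralizer (k : Type*) [Field k] [CharZero k] (N : ℕ) (hN : 1 ≤ N) (a : AN k N)
    (ha : a * Ax k N = Ax k N * a) : ∃ p : k[X], a = aeval (Ax k N) p := by
  set P := ANaux_rho k N a 1 with hP
  have hga : a = ANaux_g k N P := (ANaux_g_phi k N hN a).symm
  by_cases hm : P.natDegree = 0
  · rw [natDegree_eq_zero] at hm
    obtain ⟨p, hp⟩ := hm
    exact ⟨p, by rw [hga, ← hp, ANaux_g_C]⟩
  exfalso
  obtain ⟨m, hm⟩ : ∃ m, P.natDegree = m + 1 := ⟨P.natDegree - 1, by omega⟩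
  have hsum : a = ∑ j ∈ Finset.range (m + 2), aeval (Ax k N) (P.coeff j) * Ay k N ^ j := by
    conv_lhs => rw [hga, ANaux_g, eval₂_eq_sum_range, hm]
    rfl
  have h0 : ∑ j ∈ Finset.range (m + 2), aeval (Ax k N) (P.coeff j) *
      (Ay k N ^ j * Ax k N - Ax k N * Ay k N ^ j) = 0 := by
    rw [← sub_eq_zero.2 ha]
    conv_rhs => rw [hsum]
    rw [Finset.sum_mul, Finset.mul_sum, ← Finset.sum_sub_distrib]
    refine Finset.sum_congr rfl fun j _ => ?_
    have hc : Ax k N * aeval (Ax k N) (P.coeff j) = aeval (Ax k N) (P.coeff j) * Ax k N := by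
      conv_lhs => rw [← aeval_X (R := k) (Ax k N), aeval_X]
      have := congrArg (aeval (Ax k N)) (mul_comm X (P.coeff j))
      simpa only [map_mul, aeval_X] using this
    rw [mul_sub, ← mul_assoc, ← mul_assoc, ← mul_assoc, hc]
  have h1 := congrArg (fun z => (ANaux_rho k N z 1).coeff m) h0
  simp only [map_sum, LinearMap.sum_apply, map_mul, Module.End.mul_apply, ANaux_rho_p,
    finsetSum_coeff, coeff_C_mul, map_zero, LinearMap.zero_apply, coeff_zero] at h1
  rw [Finset.sum_range_succ, (ANaux_comm k N m).2, Finset.sum_eq_zero, zero_add] at h1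
  · have hl : P.coeff (m + 1) ≠ 0 := by
      rw [← hm]
      intro h
      have : P = 0 := by simpa using h
      rw [this] at hm; simp at hm
    have : ((m + 1 : ℕ) : k[X]) ≠ 0 := by exact_mod_cast Nat.succ_ne_zero m
    exact mul_ne_zero hl (mul_ne_zero this (pow_ne_zero _ X_ne_zero)) h1
  · intro j hj
    rw [(ANaux_comm k N j).1 m (by rw [Finset.mem_range] at hj; omega), mul_zero]

open Polynomial in
lemma ANaux_main (k : Type*) [Field k] [CharZero k] (N : ℕ) (hN : 1 ≤ N)
    (B : Type*) [Ring B] [Algebra k B] (f : AN k N →ₐ[k] B)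
    (hinj : Function.Injective f)
    (hx : IsUnit (f (Ax k N)))
    (hfrac : ∀ b : B, ∃ (a : AN k N) (n : ℕ), b * f (Ax k N) ^ n = f a) :
    Subalgebra.center k B = ⊥ := by
  rw [eq_bot_iff]
  intro b hb
  rw [Subalgebra.mem_center_iff] at hb
  obtain ⟨a, n, hab⟩ := hfrac b
  have hax : a * Ax k N = Ax k N * a := by
    apply hinj
    rw [map_mul, map_mul, ← hab, mul_assoc, ← pow_succ, pow_succ', ← mul_assoc, ← mul_assoc, hb]
  obtain ⟨p, rfl⟩ := ANaux_centralizer k N hN a hax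
  have hyn := ANaux_yp k N hN (X ^ n)
  have h1 : aeval (Ax k N) (X ^ N * derivative p) * Ax k N =
      aeval (Ax k N) (p * (C (n : k) * X ^ N)) := by
    have e1 : X ^ N * derivative (X ^ n : k[X]) * X = X ^ n * (C (n : k) * X ^ N) := by
      rcases n with _ | n
      · simp
      · simp [derivative_X_pow]; ring
    have e2 := congrArg (aeval (Ax k N)) e1
    rw [map_mul _ _ X, aeval_X, map_mul _ (X ^ n), aeval_X_pow] at e2
    have e3 := ANaux_yp k N hN p
    apply hinj
    rw [map_mul, ← sub_eq_iff_eq_add'.2 e3, map_mul _ p, map_mul f, ← hab, map_sub, map_mul, map_mul,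
      ← hab, ← mul_assoc, hb, mul_assoc b, mul_assoc b, mul_assoc b, ← mul_sub, mul_assoc b]
    congr 1
    rw [map_pow, aeval_X] at hyn
    rw [← map_pow, ← map_mul, ← map_mul, ← map_sub, ← map_mul, ← map_mul, hyn, add_sub_cancel_left]
    rw [e2]
  have h2 : X ^ N * derivative p * X = p * (C (n : k) * X ^ N) := by
    have h3 : aeval (Ax k N) (X ^ N * derivative p * X) =
      aeval (Ax k N) (p * (C (n : k) * X ^ N)) := by rw [← h1, map_mul _ _ X, aeval_X]
    have h4 := congrArg (fun z => ANaux_rho k N z 1) h3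
    simp only [ANaux_rho_p, mul_one] at h4
    exact C_injective h4
  have h3 : derivative p * X = C (n : k) * p := by
    have : (X : k[X]) ^ N ≠ 0 := pow_ne_zero _ X_ne_zero
    apply mul_left_cancel₀ this
    rw [← mul_assoc, h2]; ring
  have h4 : p = C (p.coeff n) * X ^ n := by
    ext i
    rw [coeff_C_mul_X_pow]
    split_ifs with hi
    · rw [hi]
    · have h5 := congrArg (fun q => q.coeff i) h3
      simp only [coeff_C_mul] at h5
      rcases i with _ | i
      · simp only [mul_coeff_zero, coeff_X_zero, mul_zero] at h5
        rcases mul_eq_zero.1 h5.symm with h | h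
        · exact absurd (Nat.cast_eq_zero.1 h).symm hi
        · exact h
      · rw [coeff_mul_X, coeff_derivative] at h5
        have h6 : (((i + 1 : ℕ) : k) - n) * p.coeff (i + 1) = 0 := by
          push_cast; linear_combination h5
        rcases mul_eq_zero.1 h6 with h | h
        · exact absurd (Nat.cast_injective (sub_eq_zero.1 h)) hi
        · exact h
  rw [Algebra.mem_bot]
  refine ⟨p.coeff n, ?_⟩
  apply (hx.pow n).mul_right_cancel
  rw [hab]
  conv_rhs => rw [h4]
  rw [map_mul, aeval_C, map_mul, AlgHom.commutes, map_pow, aeval_X, map_pow]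


/-- The center of the localization `A_x` of `A_N` at the powers of the normal element
`x` is `k`: for any `k`-algebra `B` realizing that localization (an injective algebra
map `A_N → B` making `x` invertible, every element of `B` being a fraction
`f(a)·f(x)^{-n}`), the center of `B` is the scalars. -/
theorem center_localization_AN (k : Type*) [Field k] [CharZero k] (N : ℕ) (hN : 1 ≤ N)
    (B : Type*) [Ring B] [Algebra k B] (f : AN k N →ₐ[k] B)
    (hinj : Function.Injective f)
    (hx : IsUnit (f (Ax k N)))
    (hfrac : ∀ b : B, ∃ (a : AN k N) (n : ℕ), b * f (Ax k N) ^ n = f a) :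
    Subalgebra.center k B = ⊥ :=
  ANaux_main k N hN B f hinj hx hfrac
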